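/- arXiv:2002.03974 — 8 statements merged into one kernel-verified Lean document; each statement's English description precedes it below -/
import Mathlib

section
/- Let d ≥ 1 and N ≥ 1, and let v_1, …, v_N be unit vectors in ℝ^d. Then max_{1 ≤ k ≤ N} Σ_{l=1}^N ⟨v_k, v_l⟩² ≥ N/d. -/
open scoped InnerProductSpace

/-- For unit vectors `v 1, …, v N` in `ℝ^d`,
`max_k Σ_l ⟨v k, v l⟩² ≥ N/d`. -/
theorem max_frame_energy_ge (d N : ℕ) (hd : 1 ≤ d) (hN : 1 ≤ N)
    (v : Fin N → EuclideanSpace ℝ (Fin d)) (hv : ∀ i, ‖v i‖ = 1) :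
    ∃ k : Fin N, (N : ℝ) / d ≤ ∑ l, ⟪v k, v l⟫_ℝ ^ 2 := by
  have hd0 : (0 : ℝ) < d := by exact_mod_cast hd
  have h1 : ∑ k, ∑ l, ⟪v k, v l⟫_ℝ ^ 2 = ∑ i, ∑ j, (∑ k, v k i * v k j) ^ 2 := by
    have e1 : ∀ k l, ⟪v k, v l⟫_ℝ ^ 2 = ∑ i, ∑ j, (v k i * v k j) * (v l i * v l j) := by
      intro k l
      rw [PiLp.inner_apply, sq, Finset.sum_mul_sum]
      refine Finset.sum_congr rfl fun i _ => Finset.sum_congr rfl fun j _ => ?_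
      simp
      ring
    have e2 : ∀ i j, (∑ k, v k i * v k j) ^ 2
        = ∑ k, ∑ l, (v k i * v k j) * (v l i * v l j) := by
      intro i j
      rw [sq, Finset.sum_mul_sum]
    simp_rw [e1, e2]
    calc _ = ∑ k, ∑ i, ∑ l, ∑ j, (v k i * v k j) * (v l i * v l j) :=
          Finset.sum_congr rfl fun k _ => Finset.sum_comm
      _ = ∑ i, ∑ k, ∑ l, ∑ j, (v k i * v k j) * (v l i * v l j) := Finset.sum_comm
      _ = ∑ i, ∑ k, ∑ j, ∑ l, (v k i * v k j) * (v l i * v l j) :=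
          Finset.sum_congr rfl fun i _ => Finset.sum_congr rfl fun k _ => Finset.sum_comm
      _ = _ := Finset.sum_congr rfl fun i _ => Finset.sum_comm
  have h2 : ∑ i, (∑ k, v k i * v k i) ^ 2 ≤ ∑ i, ∑ j, (∑ k, v k i * v k j) ^ 2 := by
    refine Finset.sum_le_sum fun i _ => ?_
    exact Finset.single_le_sum (f := fun j => (∑ k, v k i * v k j) ^ 2)
      (fun j _ => sq_nonneg _) (Finset.mem_univ i)
  have h3 : ∑ i, ∑ k, v k i * v k i = (N : ℝ) := by
    rw [Finset.sum_comm]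
    have : ∀ k, ∑ i, v k i * v k i = 1 := by
      intro k
      have h := EuclideanSpace.real_norm_sq_eq (v k)
      rw [hv k] at h
      simp_rw [← sq]
      linarith
    simp [this]
  have h4 := sq_sum_le_card_mul_sum_sq (s := (Finset.univ : Finset (Fin d)))
    (f := fun i => ∑ k, v k i * v k i)
  rw [h3, Finset.card_univ, Fintype.card_fin] at h4
  by_contra! hc
  have h5 : ∑ k, ∑ l, ⟪v k, v l⟫_ℝ ^ 2 < ∑ _k : Fin N, (N : ℝ) / d :=
    Finset.sum_lt_sum_of_nonempty ⟨⟨0, hN⟩, Finset.mem_univ _⟩ fun k _ => hc k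
  rw [Finset.sum_const, Finset.card_univ, Fintype.card_fin, nsmul_eq_mul, ← mul_div_assoc,
    lt_div_iff₀ hd0, h1] at h5
  nlinarith [mul_le_mul_of_nonneg_left h2 hd0.le]
end

section
/- Let d ≥ 1 and N ≥ 1, and let v_1, …, v_N be unit vectors in ℝ^d. Then max_{1 ≤ k ≤ N} Σ_{l=1}^N ⟨v_k, v_l⟩² = N/d if and only if the frame operator A = Σ_{i=1}^N v_i ⊗ v_i equals (N/d)·I_d, i.e. the vectors form a unit norm tight frame. -/
open scoped InnerProductSpace

/-- For unit vectors, `max_k Σ_l ⟨v k, v l⟩² = N/d` iff the frame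
operator `Σ_i v_i ⊗ v_i` equals `(N/d)·I_d`, i.e. the system is a UNTF. -/
theorem max_frame_energy_eq_iff_tight (d N : ℕ) (hd : 1 ≤ d) (hN : 1 ≤ N)
    (v : Fin N → EuclideanSpace ℝ (Fin d)) (hv : ∀ i, ‖v i‖ = 1) :
    Finset.univ.sup' (Finset.univ_nonempty_iff.mpr ⟨⟨0, hN⟩⟩)
      (fun k => ∑ l, ⟪v k, v l⟫_ℝ ^ 2) = (N : ℝ) / d ↔
    (Matrix.of fun a b => ∑ i, v i a * v i b)
      = ((N : ℝ) / d) • (1 : Matrix (Fin d) (Fin d) ℝ) := by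
  have hd0 : (d : ℝ) ≠ 0 := by positivity
  set A : Matrix (Fin d) (Fin d) ℝ := Matrix.of fun a b => ∑ i, v i a * v i b with hA
  have hAab : ∀ a b, A a b = ∑ i, v i a * v i b := fun a b => rfl
  have hn : ∀ k, ∑ a, v k a * v k a = 1 := by
    intro k
    have h := EuclideanSpace.real_norm_sq_eq (v k)
    rw [hv k] at h
    simp only [← pow_two]
    linarith
  have hE : ∀ k, ∑ l, ⟪v k, v l⟫_ℝ ^ 2 = ∑ a, ∑ b, v k a * v k b * A a b := by
    intro k
    have h1 : ∀ l, ⟪v k, v l⟫_ℝ ^ 2 = ∑ a, ∑ b, v k a * v k b * (v l a * v l b) := by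
      intro l
      rw [PiLp.inner_apply, pow_two, Finset.sum_mul_sum]
      refine Finset.sum_congr rfl fun a _ => Finset.sum_congr rfl fun b _ => ?_
      simp
      ring
    simp only [h1, hAab, Finset.mul_sum]
    rw [Finset.sum_comm]
    refine Finset.sum_congr rfl fun a _ => ?_
    rw [Finset.sum_comm]
  constructor
  · intro h
    have hle : ∀ k, ∑ a, ∑ b, v k a * v k b * A a b ≤ (N : ℝ) / d := by
      intro k
      rw [← h, ← hE k]
      exact Finset.le_sup' (fun k => ∑ l, ⟪v k, v l⟫_ℝ ^ 2) (Finset.mem_univ k)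
    have hs : ∑ a, ∑ b, A a b ^ 2 ≤ N * ((N : ℝ) / d) := by
      have h2 : ∑ k, ∑ a, ∑ b, v k a * v k b * A a b ≤ ∑ _k : Fin N, (N : ℝ) / d :=
        Finset.sum_le_sum fun k _ => hle k
      rw [Finset.sum_const, Finset.card_univ, Fintype.card_fin, nsmul_eq_mul] at h2
      refine le_trans (le_of_eq (Eq.symm ?_)) h2
      rw [Finset.sum_comm]
      refine Finset.sum_congr rfl fun a _ => ?_
      rw [Finset.sum_comm]
      refine Finset.sum_congr rfl fun b _ => ?_
      rw [← Finset.sum_mul, ← hAab, pow_two]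
    have ht : ∑ a, A a a = N := by
      simp only [hAab]
      rw [Finset.sum_comm]
      simp [hn]
    set c : ℝ := (N : ℝ) / d with hc
    have hcd : c * d = N := by rw [hc]; field_simp
    have key : ∑ a, ∑ b, (A a b - (c • (1 : Matrix (Fin d) (Fin d) ℝ)) a b) ^ 2 ≤ 0 := by
      have e : ∀ a, ∑ b, (A a b - (c • (1 : Matrix (Fin d) (Fin d) ℝ)) a b) ^ 2
          = ∑ b, A a b ^ 2 - 2 * c * A a a + c ^ 2 := by
        intro a
        have e1 : ∀ b, (A a b - (c • (1 : Matrix (Fin d) (Fin d) ℝ)) a b) ^ 2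
          = A a b ^ 2 + if a = b then (- 2 * c * A a b + c ^ 2) else 0 := by
          intro b
          by_cases hab : a = b
          · subst hab; simp; ring
          · simp [hab]
        simp only [e1, Finset.sum_add_distrib, Finset.sum_ite_eq, Finset.mem_univ, if_true]
        ring
      simp only [e, Finset.sum_add_distrib, Finset.sum_sub_distrib, ← Finset.mul_sum, ht]
      simp only [Finset.sum_const, Finset.card_univ, Fintype.card_fin, nsmul_eq_mul]
      have : (d : ℝ) * c ^ 2 = N * c := by rw [← hcd]; ring
      linarith
    have k0 := le_antisymm key
      (Finset.sum_nonneg fun a _ => Finset.sum_nonneg fun b _ => sq_nonneg _)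
    rw [Finset.sum_eq_zero_iff_of_nonneg
      (fun a _ => Finset.sum_nonneg fun b _ => sq_nonneg _)] at k0
    ext a b
    have k1 := k0 a (Finset.mem_univ a)
    rw [Finset.sum_eq_zero_iff_of_nonneg (fun b _ => sq_nonneg _)] at k1
    have k2 := k1 b (Finset.mem_univ b)
    exact sub_eq_zero.mp (pow_eq_zero_iff (two_ne_zero) |>.mp k2)
  · intro h
    have hk : ∀ k, ∑ l, ⟪v k, v l⟫_ℝ ^ 2 = (N : ℝ) / d := by
      intro k
      rw [hE k, h]
      simp only [Matrix.smul_apply, Matrix.one_apply, smul_eq_mul, mul_ite, mul_one, mul_zero,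
        Finset.sum_ite_eq, Finset.mem_univ, if_true]
      rw [← Finset.sum_mul, hn, one_mul]
    simp only [hk]
    exact Finset.sup'_const _ _
end

section
/- For any vectors v_1, …, v_N in ℝ^d with d ≥ 1, the frame potential satisfies Σ_{i=1}^N Σ_{j=1}^N ⟨v_i, v_j⟩² ≥ (Σ_{i=1}^N |v_i|²)² / d. -/
open scoped InnerProductSpace

/-- The frame potential satisfies
`Σ_{i,j} ⟨v i, v j⟩² ≥ (Σ_i |v i|²)² / d`. -/
theorem frame_potential_lower_bound (d N : ℕ) (hd : 1 ≤ d)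
    (v : Fin N → EuclideanSpace ℝ (Fin d)) :
    (∑ i, ‖v i‖ ^ 2) ^ 2 / d ≤ ∑ i, ∑ j, ⟪v i, v j⟫_ℝ ^ 2 := by
  have h1 : ∑ i, ‖v i‖ ^ 2 = ∑ a, ∑ i, v i a * v i a := by
    rw [Finset.sum_comm]
    refine Finset.sum_congr rfl fun i _ => ?_
    rw [EuclideanSpace.real_norm_sq_eq]
    exact Finset.sum_congr rfl fun a _ => sq _
  have h2 : ∑ i, ∑ j, ⟪v i, v j⟫_ℝ ^ 2 = ∑ a, ∑ b, (∑ i, v i a * v i b) ^ 2 := by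
    have e1 : ∀ i j, ⟪v i, v j⟫_ℝ ^ 2
        = ∑ a, ∑ b, (v i a * v i b) * (v j a * v j b) := by
      intro i j
      rw [PiLp.inner_apply, sq, Finset.sum_mul_sum]
      refine Finset.sum_congr rfl fun a _ => Finset.sum_congr rfl fun b _ => ?_
      simp only [RCLike.inner_apply, conj_trivial]
      ring
    have e2 : ∀ a b, (∑ i, v i a * v i b) ^ 2
        = ∑ i, ∑ j, (v i a * v i b) * (v j a * v j b) := by
      intro a b
      rw [sq, Finset.sum_mul_sum]
    simp only [e1, e2]
    calc _ = ∑ i, ∑ a, ∑ j, ∑ b, (v i a * v i b) * (v j a * v j b) :=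
          Finset.sum_congr rfl fun i _ => Finset.sum_comm
      _ = ∑ a, ∑ i, ∑ j, ∑ b, (v i a * v i b) * (v j a * v j b) := Finset.sum_comm
      _ = ∑ a, ∑ i, ∑ b, ∑ j, (v i a * v i b) * (v j a * v j b) :=
          Finset.sum_congr rfl fun a _ => Finset.sum_congr rfl fun i _ => Finset.sum_comm
      _ = _ := Finset.sum_congr rfl fun a _ => Finset.sum_comm
  have hd' : (0 : ℝ) < d := by exact_mod_cast hd
  rw [h1, h2, div_le_iff₀ hd']
  have h3 : (∑ a, ∑ i, v i a * v i a) ^ 2 ≤ (d : ℝ) * ∑ a, (∑ i, v i a * v i a) ^ 2 := by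
    simpa using sq_sum_le_card_mul_sum_sq (s := (Finset.univ : Finset (Fin d)))
      (f := fun a => ∑ i, v i a * v i a)
  have h4 : ∑ a, (∑ i, v i a * v i a) ^ 2 ≤ ∑ a, ∑ b, (∑ i, v i a * v i b) ^ 2 :=
    Finset.sum_le_sum fun a _ =>
      Finset.single_le_sum (f := fun b => (∑ i, v i a * v i b) ^ 2)
        (fun b _ => sq_nonneg _) (Finset.mem_univ a)
  nlinarith [mul_le_mul_of_nonneg_left h4 hd'.le]
end

section
/- Upper bound in the σ = 0 extremum problem: let 2 ≤ d < N, 0 < c_1 ≤ c_2, and let v_1, …, v_N ∈ ℝ^d satisfy c_1 ≤ |v_i|² ≤ c_2 for every i. Then there exists an index k such that c_1·(N − d)·|v_k|² ≤ d · Σ_{l ≠ k} ⟨v_k, v_l⟩². Equivalently, min_{1 ≤ k ≤ N} |v_k|² / Σ_{l ≠ k} ⟨v_k, v_l⟩² ≤ d / (c_1 (N − d)). -/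
open scoped InnerProductSpace

lemma frame_aux (d N : ℕ) (u : Fin N → EuclideanSpace ℝ (Fin d))
    (hu : ∀ i, ‖u i‖ ^ 2 = 1) :
    (N : ℝ) ^ 2 ≤ d * ∑ k, ∑ l, ⟪u k, u l⟫_ℝ ^ 2 := by
  have h1 : ∑ k, ∑ l, ⟪u k, u l⟫_ℝ ^ 2 = ∑ i, ∑ j, (∑ k, u k i * u k j) ^ 2 := by
    simp only [PiLp.inner_apply, sq, Finset.sum_mul_sum, RCLike.inner_apply, conj_trivial]
    have e1 : ∀ f : Fin N → Fin N → Fin d → Fin d → ℝ,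
        ∑ k, ∑ l, ∑ i, ∑ j, f k l i j = ∑ i, ∑ j, ∑ k, ∑ l, f k l i j := by
      intro f
      calc _ = ∑ k, ∑ i, ∑ l, ∑ j, f k l i j :=
            Finset.sum_congr rfl fun k _ => Finset.sum_comm
        _ = ∑ i, ∑ k, ∑ l, ∑ j, f k l i j := Finset.sum_comm
        _ = ∑ i, ∑ k, ∑ j, ∑ l, f k l i j :=
            Finset.sum_congr rfl fun i _ => Finset.sum_congr rfl fun k _ => Finset.sum_comm
        _ = _ := Finset.sum_congr rfl fun i _ => Finset.sum_comm
    rw [e1]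
    refine Finset.sum_congr rfl fun i _ => Finset.sum_congr rfl fun j _ =>
      Finset.sum_congr rfl fun k _ => Finset.sum_congr rfl fun l _ => by ring
  have h2 : ∑ i, (∑ k, u k i * u k i) ^ 2 ≤ ∑ i, ∑ j, (∑ k, u k i * u k j) ^ 2 :=
    Finset.sum_le_sum fun i _ =>
      Finset.single_le_sum (f := fun j => (∑ k, u k i * u k j) ^ 2)
        (fun j _ => sq_nonneg _) (Finset.mem_univ i)
  have h3 : ∑ i, ∑ k, u k i * u k i = (N : ℝ) := by
    rw [Finset.sum_comm]
    have : ∀ k, ∑ i, u k i * u k i = 1 := by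
      intro k
      rw [← hu k, EuclideanSpace.real_norm_sq_eq]
      simp [sq]
    simp [this]
  have h4 := sq_sum_le_card_mul_sum_sq (s := (Finset.univ : Finset (Fin d)))
    (f := fun i => ∑ k, u k i * u k i)
  rw [h3, Finset.card_univ, Fintype.card_fin] at h4
  rw [h1]
  exact h4.trans (mul_le_mul_of_nonneg_left h2 (Nat.cast_nonneg d))

/-- Upper bound in the `σ = 0` extremum problem: there is an index `k`
with `c₁(N − d)|v k|² ≤ d · Σ_{l ≠ k} ⟨v k, v l⟩²`, i.e.
`min_k |v k|²/Σ_{l ≠ k}⟨v k, v l⟩² ≤ d/(c₁(N − d))`. -/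
theorem sigma_zero_upper_bound (d N : ℕ) (hd : 2 ≤ d) (hdN : d < N)
    (c1 c2 : ℝ) (hc1 : 0 < c1) (hc12 : c1 ≤ c2)
    (v : Fin N → EuclideanSpace ℝ (Fin d))
    (hv : ∀ i, c1 ≤ ‖v i‖ ^ 2 ∧ ‖v i‖ ^ 2 ≤ c2) :
    ∃ k : Fin N, c1 * ((N : ℝ) - d) * ‖v k‖ ^ 2
      ≤ d * ∑ l ∈ Finset.univ.erase k, ⟪v k, v l⟫_ℝ ^ 2 := by
  have hpos : ∀ i, ‖v i‖ ≠ 0 := by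
    intro i h
    have := (hv i).1
    rw [h] at this
    norm_num at this
    linarith
  let u : Fin N → EuclideanSpace ℝ (Fin d) := fun i => (‖v i‖)⁻¹ • v i
  have hu : ∀ i, ‖u i‖ ^ 2 = 1 := by
    intro i
    simp [u, norm_smul, hpos i]
  have huv : ∀ k l, ⟪v k, v l⟫_ℝ ^ 2 = ‖v k‖ ^ 2 * ‖v l‖ ^ 2 * ⟪u k, u l⟫_ℝ ^ 2 := by
    intro k l
    have := hpos k
    have := hpos l
    simp only [u, real_inner_smul_left, real_inner_smul_right]
    field_simp
  have hF := frame_aux d N u hu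
  have hk : ∃ k, (N : ℝ) ≤ d * ∑ l, ⟪u k, u l⟫_ℝ ^ 2 := by
    by_contra! h
    have : ∑ k, (d * ∑ l, ⟪u k, u l⟫_ℝ ^ 2) < ∑ k : Fin N, (N : ℝ) :=
      Finset.sum_lt_sum_of_nonempty ⟨⟨0, by omega⟩, Finset.mem_univ _⟩ fun k _ => h k
    rw [← Finset.mul_sum] at this
    simp at this
    nlinarith
  obtain ⟨k, hk⟩ := hk
  refine ⟨k, ?_⟩
  rw [← Finset.add_sum_erase _ _ (Finset.mem_univ k), real_inner_self_eq_norm_sq, hu k] at hk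
  have h5 : c1 * ‖v k‖ ^ 2 * ∑ l ∈ Finset.univ.erase k, ⟪u k, u l⟫_ℝ ^ 2
      ≤ ∑ l ∈ Finset.univ.erase k, ⟪v k, v l⟫_ℝ ^ 2 := by
    rw [Finset.mul_sum]
    refine Finset.sum_le_sum fun l _ => ?_
    rw [huv, mul_comm c1]
    have := (hv l).1
    gcongr
  calc c1 * ((N : ℝ) - d) * ‖v k‖ ^ 2 = (c1 * ‖v k‖ ^ 2) * (N - d) := by ring
    _ ≤ (c1 * ‖v k‖ ^ 2) * (d * ∑ l ∈ Finset.univ.erase k, ⟪u k, u l⟫_ℝ ^ 2) := by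
        gcongr
        linarith
    _ = d * (c1 * ‖v k‖ ^ 2 * ∑ l ∈ Finset.univ.erase k, ⟪u k, u l⟫_ℝ ^ 2) := by ring
    _ ≤ _ := by gcongr
end

section
/- Characterization of maximizers in the σ = 0 problem: let 2 ≤ d < N, 0 < c_1 ≤ c_2, and let v_1, …, v_N ∈ ℝ^d satisfy c_1 ≤ |v_i|² ≤ c_2 for every i. If for every index k one has c_1·(N − d)·|v_k|² ≥ d · Σ_{l ≠ k} ⟨v_k, v_l⟩² (i.e. min_k |v_k|²/Σ_{l ≠ k}⟨v_k,v_l⟩² attains the maximal value d/(c_1(N−d))), then |v_i|² = c_1 for every i and Σ_{i=1}^N v_i ⊗ v_i = (N c_1/d)·I_d; that is, the system is a scaled copy of a unit norm tight frame with scaling factor √c_1. -/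
open scoped InnerProductSpace

lemma aux_fp (d N : ℕ) (hd : 0 < d) (u : Fin N → EuclideanSpace ℝ (Fin d))
    (hu : ∀ i, ‖u i‖ = 1) :
    ∑ a, ∑ b, ((∑ i, u i a * u i b) - if a = b then (N : ℝ) / d else 0) ^ 2
      = (∑ k, ∑ l, ⟪u k, u l⟫_ℝ ^ 2) - (N : ℝ) ^ 2 / d := by
  have hd' : (d : ℝ) ≠ 0 := by positivity
  have tr : ∑ a, ∑ i, u i a * u i a = (N : ℝ) := by
    rw [Finset.sum_comm]
    have : ∀ i, ∑ a, u i a * u i a = 1 := by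
      intro i
      have h := EuclideanSpace.real_norm_sq_eq (u i)
      rw [hu i] at h
      simp only [← pow_two]
      linarith
    simp [this]
  have fp : ∑ a, ∑ b, (∑ i, u i a * u i b) ^ 2 = ∑ k, ∑ l, ⟪u k, u l⟫_ℝ ^ 2 := by
    have e1 : ∀ k l, ⟪u k, u l⟫_ℝ ^ 2 = ∑ a, ∑ b, (u k a * u k b) * (u l a * u l b) := by
      intro k l
      rw [pow_two, PiLp.inner_apply, Finset.sum_mul_sum]
      refine Finset.sum_congr rfl fun a _ => Finset.sum_congr rfl fun b _ => ?_
      simp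
      ring
    have e2 : ∀ a b, (∑ i, u i a * u i b) ^ 2
        = ∑ k, ∑ l, (u k a * u k b) * (u l a * u l b) := by
      intro a b
      rw [pow_two, Finset.sum_mul_sum]
    simp only [e1, e2]
    simp only [← Finset.sum_product', Finset.univ_product_univ]
    have := Finset.sum_comm (s := (Finset.univ : Finset (Fin d × Fin d)))
      (t := (Finset.univ : Finset (Fin N × Fin N)))
      (f := fun p q => (u q.1 p.1 * u q.1 p.2) * (u q.2 p.1 * u q.2 p.2))
    simpa only [← Finset.univ_product_univ, Finset.sum_product] using this
  have ex : ∀ a b, ((∑ i, u i a * u i b) - if a = b then (N : ℝ) / d else 0) ^ 2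
      = (∑ i, u i a * u i b) ^ 2
        + if a = b then (- 2 * ((N : ℝ) / d) * (∑ i, u i a * u i b) + ((N : ℝ) / d) ^ 2)
          else 0 := by
    intro a b
    split_ifs <;> ring
  simp only [ex, Finset.sum_add_distrib, fp, Finset.sum_ite_eq, Finset.mem_univ, if_true,
    ← Finset.mul_sum, tr]
  simp
  field_simp
  ring

/-- Characterization of maximizers in the `σ = 0` problem: if every `k`
satisfies `c₁(N − d)|v k|² ≥ d · Σ_{l ≠ k} ⟨v k, v l⟩²`, then all vectors have
norm² equal to `c₁` and the frame operator is `(Nc₁/d)·I_d`; i.e. the system is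
a scaled copy of a UNTF with scaling factor `√c₁`. -/
theorem sigma_zero_maximizers (d N : ℕ) (hd : 2 ≤ d) (hdN : d < N)
    (c1 c2 : ℝ) (hc1 : 0 < c1) (hc12 : c1 ≤ c2)
    (v : Fin N → EuclideanSpace ℝ (Fin d))
    (hv : ∀ i, c1 ≤ ‖v i‖ ^ 2 ∧ ‖v i‖ ^ 2 ≤ c2)
    (hopt : ∀ k : Fin N, d * ∑ l ∈ Finset.univ.erase k, ⟪v k, v l⟫_ℝ ^ 2
      ≤ c1 * ((N : ℝ) - d) * ‖v k‖ ^ 2) :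
    (∀ i, ‖v i‖ ^ 2 = c1) ∧
    (Matrix.of fun a b => ∑ i, v i a * v i b)
      = ((N : ℝ) * c1 / d) • (1 : Matrix (Fin d) (Fin d) ℝ) := by
  have hd0 : (0 : ℝ) < d := by positivity
  have hN0 : (d : ℝ) < N := by exact_mod_cast hdN
  have hpos : ∀ i, 0 < ‖v i‖ := by
    intro i
    rcases (norm_nonneg (v i)).eq_or_lt with h | h
    · have := (hv i).1
      rw [← h] at this
      norm_num at this
      linarith
    · exact h
  set u : Fin N → EuclideanSpace ℝ (Fin d) := fun i => (‖v i‖)⁻¹ • v i with hu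
  have hun : ∀ i, ‖u i‖ = 1 := by
    intro i
    simp [hu, norm_smul, (hpos i).ne']
  have hvu : ∀ i, v i = ‖v i‖ • u i := by
    intro i
    simp [hu, smul_smul, (hpos i).ne']
  have hin : ∀ k l, ⟪v k, v l⟫_ℝ ^ 2 = ‖v k‖ ^ 2 * (‖v l‖ ^ 2 * ⟪u k, u l⟫_ℝ ^ 2) := by
    intro k l
    conv_lhs => rw [hvu k, hvu l, real_inner_smul_left, real_inner_smul_right]
    ring
  have h1 : ∀ k, ∑ l ∈ Finset.univ.erase k, ‖v l‖ ^ 2 * ⟪u k, u l⟫_ℝ ^ 2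
      ≤ c1 * ((N - d) / d) := by
    intro k
    have h := hopt k
    simp only [hin, ← Finset.mul_sum] at h
    have hp : 0 < ‖v k‖ ^ 2 := by have := hpos k; positivity
    rw [← mul_div_assoc, le_div_iff₀ hd0]
    refine le_of_mul_le_mul_left ?_ hp
    linarith
  have h2 : ∀ k, c1 * ∑ l ∈ Finset.univ.erase k, ⟪u k, u l⟫_ℝ ^ 2
      ≤ ∑ l ∈ Finset.univ.erase k, ‖v l‖ ^ 2 * ⟪u k, u l⟫_ℝ ^ 2 := by
    intro k
    rw [Finset.mul_sum]
    exact Finset.sum_le_sum fun l _ => mul_le_mul_of_nonneg_right (hv l).1 (sq_nonneg _)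
  have h3 : ∀ k, ∑ l ∈ Finset.univ.erase k, ⟪u k, u l⟫_ℝ ^ 2 ≤ ((N : ℝ) - d) / d := fun k =>
    le_of_mul_le_mul_left ((h2 k).trans (h1 k)) hc1
  have h4 : ∀ k, ∑ l, ⟪u k, u l⟫_ℝ ^ 2
      = 1 + ∑ l ∈ Finset.univ.erase k, ⟪u k, u l⟫_ℝ ^ 2 := by
    intro k
    rw [← Finset.add_sum_erase _ _ (Finset.mem_univ k), real_inner_self_eq_norm_sq, hun k]
    norm_num
  have h5 : ∀ k, ∑ l, ⟪u k, u l⟫_ℝ ^ 2 ≤ (N : ℝ) / d := by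
    intro k
    have := h3 k
    rw [sub_div, div_self hd0.ne'] at this
    linarith [h4 k]
  have hs : ∑ _k : Fin N, (N : ℝ) / d = (N : ℝ) ^ 2 / d := by
    simp
    ring
  have h6 : ∑ k, ∑ l, ⟪u k, u l⟫_ℝ ^ 2 ≤ (N : ℝ) ^ 2 / d := by
    rw [← hs]
    exact Finset.sum_le_sum fun k _ => h5 k
  have fp := aux_fp d N (by omega) u hun
  have hnn : 0 ≤ ∑ a, ∑ b, ((∑ i, u i a * u i b) - if a = b then (N : ℝ) / d else 0) ^ 2 :=
    Finset.sum_nonneg fun a _ => Finset.sum_nonneg fun b _ => sq_nonneg _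
  have h7 : ∑ k, ∑ l, ⟪u k, u l⟫_ℝ ^ 2 = ∑ _k : Fin N, (N : ℝ) / d := by
    rw [hs]
    linarith
  have h8 := (Finset.sum_eq_sum_iff_of_le (fun k _ => h5 k)).1 h7
  have h9 : ∀ k, ∑ l ∈ Finset.univ.erase k, ⟪u k, u l⟫_ℝ ^ 2 = ((N : ℝ) - d) / d := by
    intro k
    have := h8 k (Finset.mem_univ k)
    rw [sub_div, div_self hd0.ne']
    linarith [h4 k]
  have hten : ∀ k l, k ≠ l → (‖v l‖ ^ 2 - c1) * ⟪u k, u l⟫_ℝ ^ 2 = 0 := by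
    intro k l hkl
    have hz : ∑ l ∈ Finset.univ.erase k, (‖v l‖ ^ 2 - c1) * ⟪u k, u l⟫_ℝ ^ 2 ≤ 0 := by
      simp only [sub_mul, Finset.sum_sub_distrib, ← Finset.mul_sum]
      rw [h9 k]
      linarith [h1 k]
    have hq : ∀ l ∈ Finset.univ.erase k, 0 ≤ (‖v l‖ ^ 2 - c1) * ⟪u k, u l⟫_ℝ ^ 2 :=
      fun l _ => mul_nonneg (by linarith [(hv l).1]) (sq_nonneg _)
    exact (Finset.sum_eq_zero_iff_of_nonneg hq).1
      (le_antisymm hz (Finset.sum_nonneg hq)) l (by simp [hkl.symm])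
  have hnorm : ∀ i, ‖v i‖ ^ 2 = c1 := by
    intro i
    by_contra hne
    have hz : ∑ l ∈ Finset.univ.erase i, ⟪u i, u l⟫_ℝ ^ 2 = 0 := by
      refine Finset.sum_eq_zero fun l hl => ?_
      rw [real_inner_comm]
      exact (mul_eq_zero.1 (hten l i (Finset.ne_of_mem_erase hl))).resolve_left
        (sub_ne_zero.2 hne)
    rw [h9 i] at hz
    have : 0 < ((N : ℝ) - d) / d := div_pos (by linarith) hd0
    linarith
  refine ⟨hnorm, ?_⟩
  have hS : ∀ a b, (∑ i, u i a * u i b) - (if a = b then (N : ℝ) / d else 0) = 0 := by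
    intro a b
    have h0 : ∑ a, ∑ b, ((∑ i, u i a * u i b) - if a = b then (N : ℝ) / d else 0) ^ 2 = 0 := by
      linarith
    have ha := (Finset.sum_eq_zero_iff_of_nonneg
      (fun a _ => Finset.sum_nonneg fun b _ => sq_nonneg _)).1 h0 a (Finset.mem_univ a)
    have hb := (Finset.sum_eq_zero_iff_of_nonneg
      (fun b _ => sq_nonneg _)).1 ha b (Finset.mem_univ b)
    exact pow_eq_zero_iff (two_ne_zero) |>.1 hb
  ext a b
  have hc : ∀ i, v i a * v i b = c1 * (u i a * u i b) := by
    intro i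
    have e : ∀ x, v i x = ‖v i‖ * u i x := by
      intro x
      conv_lhs => rw [hvu i]
      simp
    rw [e a, e b, ← hnorm i]
    ring
  simp only [Matrix.of_apply, Matrix.smul_apply, Matrix.one_apply, smul_eq_mul, hc,
    ← Finset.mul_sum, sub_eq_zero.1 (hS a b)]
  split_ifs
  · ring
  · ring
end

section
/- Theorem (uniform systems, σ > 0): let 2 ≤ d < N, 0 < c_1 ≤ c_2, σ ≥ 0 with σ² ≤ c_1²(N − d)/d. Let c ∈ [c_1, c_2] and let v_1, …, v_N ∈ ℝ^d satisfy |v_i|² = c for every i. Then there exists an index k such that |v_k|² · (σ² + c_1²(N − d)/d) ≤ c_1 · (σ² + Σ_{l ≠ k} ⟨v_k, v_l⟩²); equivalently, min_{1 ≤ k ≤ N} |v_k|²/(σ² + Σ_{l ≠ k} ⟨v_k, v_l⟩²) ≤ c_1/(σ² + c_1²(N − d)/d). Moreover, if |v_i|² = c_1 for all i and Σ_i v_i ⊗ v_i = (N c_1/d)·I_d, then equality holds for every k. -/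
open scoped InnerProductSpace

theorem row_formula {d N : ℕ} (v : Fin N → EuclideanSpace ℝ (Fin d)) (k : Fin N) :
    ∑ l, ⟪v k, v l⟫_ℝ ^ 2 = ∑ a, ∑ b, v k a * v k b * ∑ l, v l a * v l b := by
  have h : ∀ l, ⟪v k, v l⟫_ℝ ^ 2 = ∑ a, ∑ b, v k a * v k b * (v l a * v l b) := by
    intro l
    rw [PiLp.inner_apply, sq, Finset.sum_mul_sum]
    refine Finset.sum_congr rfl fun a _ => Finset.sum_congr rfl fun b _ => ?_
    simp only [RCLike.inner_apply, conj_trivial]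
    ring
  simp only [h, Finset.mul_sum]
  rw [Finset.sum_comm]
  exact Finset.sum_congr rfl fun a _ => Finset.sum_comm

theorem total_formula {d N : ℕ} (v : Fin N → EuclideanSpace ℝ (Fin d)) :
    ∑ k, ∑ l, ⟪v k, v l⟫_ℝ ^ 2 = ∑ a, ∑ b, (∑ l, v l a * v l b) ^ 2 := by
  simp only [row_formula]
  rw [Finset.sum_comm]
  refine Finset.sum_congr rfl fun a _ => ?_
  rw [Finset.sum_comm]
  refine Finset.sum_congr rfl fun b _ => ?_
  rw [← Finset.sum_mul, sq]

theorem norm_formula {d : ℕ} (x : EuclideanSpace ℝ (Fin d)) : ‖x‖ ^ 2 = ∑ a, x a * x a := by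
  rw [EuclideanSpace.real_norm_sq_eq]
  simp only [sq]

theorem welch {d N : ℕ} (v : Fin N → EuclideanSpace ℝ (Fin d)) :
    (∑ i, ‖v i‖ ^ 2) ^ 2 ≤ d * ∑ k, ∑ l, ⟪v k, v l⟫_ℝ ^ 2 := by
  rw [total_formula]
  simp only [norm_formula]
  rw [Finset.sum_comm]
  have h1 := sq_sum_le_card_mul_sum_sq (s := (Finset.univ : Finset (Fin d)))
    (f := fun a => ∑ i, v i a * v i a)
  rw [Finset.card_univ, Fintype.card_fin] at h1
  refine h1.trans ?_
  refine mul_le_mul_of_nonneg_left ?_ (Nat.cast_nonneg d)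
  refine Finset.sum_le_sum fun a _ => ?_
  exact Finset.single_le_sum (f := fun b => (∑ l, v l a * v l b) ^ 2)
    (fun b _ => sq_nonneg _) (Finset.mem_univ a)

/-- For uniform systems (`|v i|² = c`, `c₁ ≤ c ≤ c₂`) and
`σ² ≤ c₁²(N − d)/d`, some index `k` satisfies
`|v k|²·(σ² + c₁²(N − d)/d) ≤ c₁·(σ² + Σ_{l ≠ k} ⟨v k, v l⟩²)`, i.e.
`min_k |v k|²/(σ² + Σ_{l ≠ k}⟨v k, v l⟩²) ≤ c₁/(σ² + c₁²(N − d)/d)`.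
Moreover, equality holds for every `k` when `|v i|² = c₁` for all `i` and the
frame operator is `(Nc₁/d)·I_d`. -/
theorem uniform_sigma_positive (d N : ℕ) (hd : 2 ≤ d) (hdN : d < N)
    (c1 c2 σ : ℝ) (hc1 : 0 < c1) (hc12 : c1 ≤ c2) (hσ : 0 ≤ σ)
    (hσ2 : σ ^ 2 ≤ c1 ^ 2 * ((N : ℝ) - d) / d)
    (c : ℝ) (hcc1 : c1 ≤ c) (hcc2 : c ≤ c2)
    (v : Fin N → EuclideanSpace ℝ (Fin d)) (hv : ∀ i, ‖v i‖ ^ 2 = c) :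
    (∃ k : Fin N, ‖v k‖ ^ 2 * (σ ^ 2 + c1 ^ 2 * ((N : ℝ) - d) / d)
      ≤ c1 * (σ ^ 2 + ∑ l ∈ Finset.univ.erase k, ⟪v k, v l⟫_ℝ ^ 2)) ∧
    ((∀ i, ‖v i‖ ^ 2 = c1) →
      (Matrix.of fun a b => ∑ i, v i a * v i b)
        = ((N : ℝ) * c1 / d) • (1 : Matrix (Fin d) (Fin d) ℝ) →
      ∀ k : Fin N, ‖v k‖ ^ 2 * (σ ^ 2 + c1 ^ 2 * ((N : ℝ) - d) / d)
        = c1 * (σ ^ 2 + ∑ l ∈ Finset.univ.erase k, ⟪v k, v l⟫_ℝ ^ 2)) := by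
  have hd0 : (0 : ℝ) < d := by exact_mod_cast (by omega : 0 < d)
  have hN0 : (0 : ℝ) < N := by exact_mod_cast (by omega : 0 < N)
  have hNd : (d : ℝ) < N := by exact_mod_cast hdN
  have her : ∀ k : Fin N, ∑ l ∈ Finset.univ.erase k, ⟪v k, v l⟫_ℝ ^ 2
      = ∑ l, ⟪v k, v l⟫_ℝ ^ 2 - c ^ 2 := by
    intro k
    rw [← Finset.add_sum_erase _ _ (Finset.mem_univ k), real_inner_self_eq_norm_sq, hv k]
    ring
  constructor
  · obtain ⟨k, hk⟩ : ∃ k : Fin N, N * c ^ 2 / d ≤ ∑ l, ⟪v k, v l⟫_ℝ ^ 2 := by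
      by_contra! hcon
      have hw := welch v
      have hlt : ∑ k, ∑ l, ⟪v k, v l⟫_ℝ ^ 2 < ∑ _k : Fin N, (N * c ^ 2 / d : ℝ) :=
        Finset.sum_lt_sum_of_nonempty ⟨⟨0, by omega⟩, Finset.mem_univ _⟩ fun k _ => hcon k
      simp only [hv, Finset.sum_const, Finset.card_univ, Fintype.card_fin, nsmul_eq_mul]
        at hw hlt
      have h2 := mul_lt_mul_of_pos_left hlt hd0
      have h3 : (d : ℝ) * (N * (N * c ^ 2 / d)) = (N * c) ^ 2 := by
        field_simp
      linarith
    refine ⟨k, ?_⟩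
    rw [her, hv]
    set S := ∑ l, ⟪v k, v l⟫_ℝ ^ 2
    set A : ℝ := (N - d) / d with hA
    have hA0 : 0 ≤ A := div_nonneg (by linarith) hd0.le
    have e1 : c1 ^ 2 * ((N : ℝ) - d) / d = c1 ^ 2 * A := by rw [hA]; ring
    have e2 : N * c ^ 2 / d = c ^ 2 * A + c ^ 2 := by rw [hA]; field_simp; ring
    rw [e1] at hσ2 ⊢
    rw [e2] at hk
    have h4 : c1 * (c ^ 2 * A) ≤ c1 * (S - c ^ 2) :=
      mul_le_mul_of_nonneg_left (by linarith) hc1.le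
    have h5 : c1 ^ 2 * A ≤ c * c1 * A := by
      apply mul_le_mul_of_nonneg_right _ hA0
      nlinarith
    have h6 : 0 ≤ (c - c1) * (c * c1 * A - σ ^ 2) :=
      mul_nonneg (by linarith) (by linarith)
    nlinarith
  · intro h1 hF k
    have hcc : c = c1 := by rw [← hv k, h1 k]
    have hab : ∀ a b, ∑ l, v l a * v l b = if a = b then (N : ℝ) * c1 / d else 0 := by
      intro a b
      have := congrFun (congrFun hF a) b
      simpa [Matrix.one_apply] using this
    rw [her, row_formula, hcc, h1]
    have h7 : ∑ a, ∑ b, v k a * v k b * ∑ l, v l a * v l b = N * c1 / d * c1 := by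
      simp only [hab, mul_ite, mul_zero, Finset.sum_ite_eq, Finset.mem_univ, if_true]
      rw [← Finset.sum_mul, ← norm_formula, h1]
      ring
    rw [h7]
    field_simp
end

section
/- Welch bound: let d ≥ 1, M ≥ 2, c_1 > 0, and let w_1, …, w_M ∈ ℝ^d satisfy |w_i|² ≥ c_1 for every i. Then there exist indices i ≠ j such that ⟨w_i, w_j⟩² ≥ c_1²(M − d) / (d(M − 1)); equivalently max_{i ≠ j} ⟨w_i, w_j⟩² ≥ c_1²(M − d)/(d(M − 1)). -/
open scoped InnerProductSpace

lemma frame_pot (d M : ℕ) (u : Fin M → Fin d → ℝ) (hu : ∀ i, ∑ a, u i a ^ 2 = 1) :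
    (M : ℝ) ^ 2 ≤ d * ∑ i, ∑ j, (∑ a, u i a * u j a) ^ 2 := by
  have h1 : ∑ i, ∑ j, (∑ a, u i a * u j a) ^ 2 = ∑ a, ∑ b, (∑ i, u i a * u i b) ^ 2 := by
    simp only [sq, Finset.sum_mul_sum]
    calc ∑ i, ∑ j, ∑ a, ∑ b, u i a * u j a * (u i b * u j b)
        = ∑ i, ∑ a, ∑ j, ∑ b, u i a * u j a * (u i b * u j b) := by
          refine Finset.sum_congr rfl fun i _ => Finset.sum_comm
      _ = ∑ a, ∑ i, ∑ j, ∑ b, u i a * u j a * (u i b * u j b) := Finset.sum_comm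
      _ = ∑ a, ∑ i, ∑ b, ∑ j, u i a * u j a * (u i b * u j b) := by
          refine Finset.sum_congr rfl fun a _ => Finset.sum_congr rfl fun i _ => Finset.sum_comm
      _ = ∑ a, ∑ b, ∑ i, ∑ j, u i a * u j a * (u i b * u j b) := by
          refine Finset.sum_congr rfl fun a _ => Finset.sum_comm
      _ = _ := by
          refine Finset.sum_congr rfl fun a _ => Finset.sum_congr rfl fun b _ =>
            Finset.sum_congr rfl fun i _ => Finset.sum_congr rfl fun j _ => by ring
  have h2 : ∑ a, (∑ i, u i a ^ 2) ^ 2 ≤ ∑ a, ∑ b, (∑ i, u i a * u i b) ^ 2 := by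
    refine Finset.sum_le_sum fun a _ => ?_
    have := Finset.single_le_sum (f := fun b => (∑ i, u i a * u i b) ^ 2)
      (fun b _ => sq_nonneg _) (Finset.mem_univ a)
    simpa [← sq] using this
  have h3 : ∑ a, ∑ i, u i a ^ 2 = (M : ℝ) := by
    rw [Finset.sum_comm]; simp [hu]
  have h4 := sq_sum_le_card_mul_sum_sq (s := Finset.univ) (f := fun a => ∑ i, u i a ^ 2)
  rw [h3] at h4
  simp only [Finset.card_univ, Fintype.card_fin] at h4
  rw [h1]
  exact h4.trans (mul_le_mul_of_nonneg_left h2 (Nat.cast_nonneg d))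

/-- Welch bound: if `|w i|² ≥ c₁` for `M ≥ 2` vectors in `ℝ^d`, then
some pair `i ≠ j` satisfies `⟨w i, w j⟩² ≥ c₁²(M − d)/(d(M − 1))`. -/
theorem welch_bound (d M : ℕ) (hd : 1 ≤ d) (hM : 2 ≤ M) (c1 : ℝ) (hc1 : 0 < c1)
    (w : Fin M → EuclideanSpace ℝ (Fin d)) (hw : ∀ i, c1 ≤ ‖w i‖ ^ 2) :
    ∃ i j : Fin M, i ≠ j ∧
      c1 ^ 2 * ((M : ℝ) - d) / (d * ((M : ℝ) - 1)) ≤ ⟪w i, w j⟫_ℝ ^ 2 := by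
  by_contra! hcon
  have hd' : (1 : ℝ) ≤ d := by exact_mod_cast hd
  have hM' : (2 : ℝ) ≤ M := by exact_mod_cast hM
  have hpos : ∀ i, 0 < ‖w i‖ ^ 2 := fun i => hc1.trans_le (hw i)
  have hne : ∀ i, ‖w i‖ ≠ 0 := fun i h => by have := hpos i; simp [h] at this
  set K : ℝ := ((M : ℝ) - d) / (d * ((M : ℝ) - 1)) with hK
  set u : Fin M → Fin d → ℝ := fun i a => w i a / ‖w i‖ with hu_def
  have hin : ∀ i j, ∑ a, u i a * u j a = ⟪w i, w j⟫_ℝ / (‖w i‖ * ‖w j‖) := by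
    intro i j
    rw [PiLp.inner_apply, Finset.sum_div]
    refine Finset.sum_congr rfl fun a _ => ?_
    simp [hu_def, div_mul_div_comm, mul_comm]
  have hu : ∀ i, ∑ a, u i a ^ 2 = 1 := by
    intro i
    have := hin i i
    rw [real_inner_self_eq_norm_mul_norm, div_self (mul_ne_zero (hne i) (hne i))] at this
    simpa [sq] using this
  have hlt : ∀ i j, i ≠ j → (∑ a, u i a * u j a) ^ 2 < K := by
    intro i j hij
    have h := hcon i j hij
    rw [mul_div_assoc] at h
    have hKpos : 0 < K := by
      by_contra hk
      have : c1 ^ 2 * K ≤ 0 := mul_nonpos_of_nonneg_of_nonpos (sq_nonneg _) (not_lt.mp hk)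
      have := sq_nonneg (⟪w i, w j⟫_ℝ)
      linarith
    rw [hin, div_pow, mul_pow, div_lt_iff₀ (mul_pos (hpos i) (hpos j))]
    have h2 : c1 ^ 2 ≤ ‖w i‖ ^ 2 * ‖w j‖ ^ 2 := by
      rw [sq c1]; exact mul_le_mul (hw i) (hw j) hc1.le (hpos i).le
    nlinarith [mul_le_mul_of_nonneg_left h2 hKpos.le]
  have hrow : ∀ i, ∑ j, (∑ a, u i a * u j a) ^ 2 < 1 + (M - 1) * K := by
    intro i
    rw [← Finset.add_sum_erase _ _ (Finset.mem_univ i)]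
    have e : (∑ a, u i a * u i a) = 1 := by simpa [sq] using hu i
    rw [e, one_pow]
    have hc : ((Finset.univ.erase i).card : ℝ) = M - 1 := by
      rw [Finset.card_erase_of_mem (Finset.mem_univ i), Finset.card_univ, Fintype.card_fin,
        Nat.cast_sub (by omega), Nat.cast_one]
    have hnon : (Finset.univ.erase i).Nonempty := by
      rw [← Finset.card_pos]
      have : (0 : ℝ) < ((Finset.univ.erase i).card : ℝ) := by rw [hc]; linarith
      exact_mod_cast this
    have := Finset.sum_lt_sum_of_nonempty hnon (f := fun j => (∑ a, u i a * u j a) ^ 2)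
      (g := fun _ => K) (fun j hj => hlt i j (Finset.ne_of_mem_erase hj).symm)
    rw [Finset.sum_const, nsmul_eq_mul, hc] at this
    linarith
  have htot : ∑ i, ∑ j, (∑ a, u i a * u j a) ^ 2 < M * (1 + (M - 1) * K) := by
    have := Finset.sum_lt_sum_of_nonempty (s := (Finset.univ : Finset (Fin M)))
      ⟨⟨0, by omega⟩, Finset.mem_univ _⟩ (fun i _ => hrow i)
    simpa [mul_add] using this
  have hfp := frame_pot d M u hu
  have h5 : (d : ℝ) * (M * (1 + (M - 1) * K)) = M ^ 2 := by
    have : (M : ℝ) - 1 ≠ 0 := by linarith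
    have : (d : ℝ) ≠ 0 := by linarith
    rw [hK]; field_simp; ring
  have := mul_lt_mul_of_pos_left htot (by linarith : (0 : ℝ) < d)
  linarith
end

section
/- Theorem (structure of sum-minimal extremal systems): let 2 ≤ d < N, 0 < c_1 ≤ c_2, σ > 0 with c_1² > d·σ². Let S ⊂ (ℝ^d)^N be the set of systems (v_1, …, v_N) with c_1 ≤ |v_i|² ≤ c_2 for all i, and let F(v) = min_{1 ≤ k ≤ N} |v_k|²/(σ² + Σ_{l ≠ k} ⟨v_k, v_l⟩²). Suppose (v_i)_{i=1}^N ∈ S maximizes F on S, and moreover minimizes Σ_{i=1}^N |v_i|² among all maximizers of F on S. Then the number of indices i with |v_i|² > c_1 is at most d(c_1² − σ²)/(c_1² − dσ²). -/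
open scoped InnerProductSpace

lemma frame_bound {d N : ℕ} (I : Finset (Fin N)) (u : Fin N → EuclideanSpace ℝ (Fin d))
    (hu : ∀ i ∈ I, ‖u i‖ ^ 2 = 1) :
    (I.card : ℝ) ^ 2 ≤ d * ∑ k ∈ I, ∑ l ∈ I, ⟪u k, u l⟫_ℝ ^ 2 := by
  set G : Fin d → Fin d → ℝ := fun a b => ∑ k ∈ I, u k a * u k b with hG
  have h1 : ∑ k ∈ I, ∑ l ∈ I, ⟪u k, u l⟫_ℝ ^ 2 = ∑ a, ∑ b, G a b ^ 2 := by
    have e1 : ∀ k l, ⟪u k, u l⟫_ℝ ^ 2 = ∑ a, ∑ b, (u k a * u k b) * (u l a * u l b) := by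
      intro k l
      rw [PiLp.inner_apply, sq, Finset.sum_mul_sum]
      refine Finset.sum_congr rfl fun a _ => Finset.sum_congr rfl fun b _ => ?_
      simp
      ring
    have e2 : ∀ a b, G a b ^ 2 = ∑ k ∈ I, ∑ l ∈ I, (u k a * u k b) * (u l a * u l b) := by
      intro a b
      rw [hG, sq, Finset.sum_mul_sum]
    simp_rw [e1, e2]
    calc _ = ∑ k ∈ I, ∑ a, ∑ l ∈ I, ∑ b, (u k a * u k b) * (u l a * u l b) := by
            refine Finset.sum_congr rfl fun k _ => Finset.sum_comm
      _ = ∑ a, ∑ k ∈ I, ∑ l ∈ I, ∑ b, (u k a * u k b) * (u l a * u l b) := Finset.sum_comm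
      _ = _ := by
            refine Finset.sum_congr rfl fun a _ => ?_
            calc _ = ∑ k ∈ I, ∑ b, ∑ l ∈ I, (u k a * u k b) * (u l a * u l b) := by
                    refine Finset.sum_congr rfl fun k _ => Finset.sum_comm
              _ = _ := Finset.sum_comm
  have h2 : ∑ a, G a a = I.card := by
    rw [hG, Finset.sum_comm]
    rw [Finset.sum_congr rfl (g := fun _ => (1:ℝ))]
    · simp
    · intro k hk
      rw [← hu k hk, EuclideanSpace.norm_sq_eq]
      refine Finset.sum_congr rfl fun a _ => ?_
      rw [Real.norm_eq_abs, sq_abs, sq]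
  have h3 : ∑ a, G a a ^ 2 ≤ ∑ a, ∑ b, G a b ^ 2 := by
    refine Finset.sum_le_sum fun a _ => ?_
    exact Finset.single_le_sum (f := fun b => G a b ^ 2) (fun b _ => sq_nonneg _)
      (Finset.mem_univ a)
  have h4 := sq_sum_le_card_mul_sum_sq (s := (Finset.univ : Finset (Fin d))) (f := fun a => G a a)
  rw [h2, Finset.card_univ, Fintype.card_fin] at h4
  rw [h1]
  exact h4.trans (mul_le_mul_of_nonneg_left h3 (Nat.cast_nonneg d))

lemma card_bound {d N : ℕ} (I : Finset (Fin N)) (v : Fin N → EuclideanSpace ℝ (Fin d))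
    (c s : ℝ) (hc : 0 < c) (hv : ∀ i ∈ I, c ≤ ‖v i‖ ^ 2)
    (hp : ∀ i ∈ I, ∀ j ∈ I, i ≠ j → ⟪v i, v j⟫_ℝ ^ 2 ≤ s) (hI : 0 < I.card) :
    (I.card : ℝ) * c ^ 2 ≤ d * (c ^ 2 + (I.card - 1) * s) := by
  have hpos : ∀ i ∈ I, 0 < ‖v i‖ := by
    intro i hi
    have := hv i hi
    by_contra h
    have h0 : ‖v i‖ = 0 := le_antisymm (not_lt.mp h) (norm_nonneg _)
    rw [h0] at this
    norm_num at this
    linarith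
  have hf := frame_bound I (fun i => (‖v i‖)⁻¹ • v i) (by
    intro i hi
    have := hpos i hi
    rw [norm_smul, norm_inv, norm_norm, inv_mul_cancel₀ this.ne', one_pow])
  have hrow : ∀ k ∈ I, ∑ l ∈ I, ⟪(‖v k‖)⁻¹ • v k, (‖v l‖)⁻¹ • v l⟫_ℝ ^ 2
      ≤ 1 + (I.card - 1) * (s / c ^ 2) := by
    intro k hk
    rw [← Finset.add_sum_erase I _ hk]
    have a1 : ⟪(‖v k‖)⁻¹ • v k, (‖v k‖)⁻¹ • v k⟫_ℝ ^ 2 = 1 := by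
      have := hpos k hk
      rw [real_inner_self_eq_norm_sq, norm_smul, norm_inv, norm_norm, inv_mul_cancel₀ this.ne']
      norm_num
    rw [a1]
    have a2 : ∀ l ∈ I.erase k, ⟪(‖v k‖)⁻¹ • v k, (‖v l‖)⁻¹ • v l⟫_ℝ ^ 2 ≤ s / c ^ 2 := by
      intro l hl
      obtain ⟨hlk, hl⟩ := Finset.mem_erase.mp hl
      have h1 := hp k hk l hl (Ne.symm hlk)
      have hk1 := hpos k hk
      have hl1 := hpos l hl
      rw [real_inner_smul_left, real_inner_smul_right]
      have e : ((‖v k‖)⁻¹ * ((‖v l‖)⁻¹ * ⟪v k, v l⟫_ℝ)) ^ 2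
          = ⟪v k, v l⟫_ℝ ^ 2 / (‖v k‖ ^ 2 * ‖v l‖ ^ 2) := by
        field_simp
      rw [e]
      refine div_le_div₀ ((sq_nonneg _).trans h1) h1 (by positivity) ?_
      rw [sq c]
      exact mul_le_mul (hv k hk) (hv l hl) hc.le (by positivity)
    have a3 := Finset.sum_le_card_nsmul _ _ _ a2
    rw [Finset.card_erase_of_mem hk, nsmul_eq_mul, Nat.cast_sub hI, Nat.cast_one] at a3
    linarith
  have hs := Finset.sum_le_card_nsmul _ _ _ hrow
  rw [nsmul_eq_mul] at hs
  have hM : (0:ℝ) < I.card := Nat.cast_pos.mpr hI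
  have h5 := hf.trans (mul_le_mul_of_nonneg_left hs (Nat.cast_nonneg d))
  have h6 : (I.card : ℝ) ≤ d * (1 + (I.card - 1) * (s / c ^ 2)) := by
    refine le_of_mul_le_mul_left ?_ hM
    linarith
  have h7 := mul_le_mul_of_nonneg_right h6 (sq_nonneg c)
  have e : (d * (1 + ((I.card:ℝ) - 1) * (s / c ^ 2))) * c ^ 2
      = d * (c ^ 2 + (I.card - 1) * s) := by
    field_simp
  rwa [e] at h7

/-- Structure of sum-minimal extremal systems: if `v` maximizes
`F(w) = min_k |w k|²/(σ² + Σ_{l ≠ k}⟨w k, w l⟩²)` over the systems with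
`c₁ ≤ |w i|² ≤ c₂`, and minimizes `Σ_i |w i|²` among these maximizers, then the
number of indices `i` with `|v i|² > c₁` is at most `d(c₁² − σ²)/(c₁² − dσ²)`. -/
theorem sum_minimal_extremal_structure (d N : ℕ) (hd : 2 ≤ d) (hdN : d < N)
    (c1 c2 σ : ℝ) (hc1 : 0 < c1) (hc12 : c1 ≤ c2) (hσ : 0 < σ)
    (hσ2 : (d : ℝ) * σ ^ 2 < c1 ^ 2)
    (F : (Fin N → EuclideanSpace ℝ (Fin d)) → ℝ)
    (hF : ∀ w, F w = ⨅ k : Fin N,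
      ‖w k‖ ^ 2 / (σ ^ 2 + ∑ l ∈ Finset.univ.erase k, ⟪w k, w l⟫_ℝ ^ 2))
    (v : Fin N → EuclideanSpace ℝ (Fin d))
    (hv : ∀ i, c1 ≤ ‖v i‖ ^ 2 ∧ ‖v i‖ ^ 2 ≤ c2)
    (hmax : ∀ w : Fin N → EuclideanSpace ℝ (Fin d),
      (∀ i, c1 ≤ ‖w i‖ ^ 2 ∧ ‖w i‖ ^ 2 ≤ c2) → F w ≤ F v)
    (hmin : ∀ w : Fin N → EuclideanSpace ℝ (Fin d),
      (∀ i, c1 ≤ ‖w i‖ ^ 2 ∧ ‖w i‖ ^ 2 ≤ c2) → F w = F v →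
      ∑ i, ‖v i‖ ^ 2 ≤ ∑ i, ‖w i‖ ^ 2) :
    ((Finset.univ.filter fun i => c1 < ‖v i‖ ^ 2).card : ℝ)
      ≤ d * (c1 ^ 2 - σ ^ 2) / (c1 ^ 2 - d * σ ^ 2) := by
  have hpair : ∀ i ∈ Finset.univ.filter (fun i => c1 < ‖v i‖ ^ 2),
      ∀ j ∈ Finset.univ.filter (fun i => c1 < ‖v i‖ ^ 2), i ≠ j →
      ⟪v i, v j⟫_ℝ ^ 2 ≤ σ ^ 2 := by
    intro i hi j hj hij
    have hi := (Finset.mem_filter.mp hi).2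
    have hj := (Finset.mem_filter.mp hj).2
    by_contra hlt
    have hlt := not_le.mp hlt
    have hσ' : 0 < σ ^ 2 := by positivity
    obtain ⟨x, hx, hx1⟩ : ∃ x, max (σ ^ 2 / ⟪v i, v j⟫_ℝ ^ 2)
        (max (c1 / ‖v i‖ ^ 2) (c1 / ‖v j‖ ^ 2)) < x ∧ x < 1 := by
      apply exists_between
      refine max_lt ((div_lt_one (by linarith)).mpr hlt)
        (max_lt ((div_lt_one (by linarith)).mpr hi) ((div_lt_one (by linarith)).mpr hj))
    obtain ⟨hxa, hx'⟩ := max_lt_iff.mp hx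
    obtain ⟨hxi, hxj⟩ := max_lt_iff.mp hx'
    rw [div_lt_iff₀ (by linarith)] at hxa hxi hxj
    have hx0 : 0 < x := by
      by_contra h
      nlinarith [not_lt.mp h, sq_nonneg ⟪v i, v j⟫_ℝ]
    set s : Fin N → ℝ := fun k => if k = i ∨ k = j then x else 1 with hs
    have hs0 : ∀ k, 0 < s k := by
      intro k; simp only [hs]; split_ifs <;> linarith
    have hs1 : ∀ k, s k ≤ 1 := by
      intro k; simp only [hs]; split_ifs <;> linarith
    set w : Fin N → EuclideanSpace ℝ (Fin d) := fun k => √(s k) • v k with hw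
    have hwn : ∀ k, ‖w k‖ ^ 2 = s k * ‖v k‖ ^ 2 := by
      intro k
      simp only [hw]
      rw [norm_smul, mul_pow, Real.norm_eq_abs, sq_abs, Real.sq_sqrt (hs0 k).le]
    have hwi : ∀ k l, ⟪w k, w l⟫_ℝ ^ 2 = s k * (s l * ⟪v k, v l⟫_ℝ ^ 2) := by
      intro k l
      simp only [hw]
      rw [real_inner_smul_left, real_inner_smul_right, mul_pow, mul_pow,
        Real.sq_sqrt (hs0 k).le, Real.sq_sqrt (hs0 l).le]
    have hwS : ∀ k, c1 ≤ ‖w k‖ ^ 2 ∧ ‖w k‖ ^ 2 ≤ c2 := by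
      intro k
      rw [hwn]
      refine ⟨?_, ?_⟩
      · simp only [hs]
        split_ifs with h
        · rcases h with rfl | rfl <;> linarith
        · linarith [(hv k).1]
      · nlinarith [(hv k).2, hs1 k, sq_nonneg ‖v k‖]
    have key : ∀ p q, p ≠ q → s p = x → s q = x →
        σ ^ 2 < x * ⟪v p, v q⟫_ℝ ^ 2 →
        σ ^ 2 + ∑ l ∈ Finset.univ.erase p, ⟪w p, w l⟫_ℝ ^ 2
        ≤ s p * (σ ^ 2 + ∑ l ∈ Finset.univ.erase p, ⟪v p, v l⟫_ℝ ^ 2) := by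
      intro p q hpq hsp hsq hlt
      simp_rw [hwi]
      rw [← Finset.mul_sum, hsp]
      have hq : q ∈ Finset.univ.erase p := Finset.mem_erase.mpr ⟨hpq.symm, Finset.mem_univ _⟩
      rw [← Finset.add_sum_erase _ _ hq, ← Finset.add_sum_erase _ (fun l => ⟪v p, v l⟫_ℝ ^ 2) hq,
        hsq]
      have h1 : ∑ l ∈ (Finset.univ.erase p).erase q, s l * ⟪v p, v l⟫_ℝ ^ 2
          ≤ ∑ l ∈ (Finset.univ.erase p).erase q, ⟪v p, v l⟫_ℝ ^ 2 :=
        Finset.sum_le_sum fun l _ => mul_le_of_le_one_left (sq_nonneg _) (hs1 l)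
      have h2 := mul_le_mul_of_nonneg_left h1 hx0.le
      have h3 := mul_le_mul_of_nonneg_left hlt.le (sub_nonneg.mpr hx1.le)
      linarith
    have hden : ∀ k, σ ^ 2 + ∑ l ∈ Finset.univ.erase k, ⟪w k, w l⟫_ℝ ^ 2
        ≤ s k * (σ ^ 2 + ∑ l ∈ Finset.univ.erase k, ⟪v k, v l⟫_ℝ ^ 2) := by
      intro k
      have hsi : s i = x := by simp [hs]
      have hsj : s j = x := by simp [hs]
      by_cases hki : k = i
      · rw [hki]
        exact key i j hij hsi hsj hxa
      · by_cases hkj : k = j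
        · rw [hkj]
          exact key j i hij.symm hsj hsi (by rwa [real_inner_comm])
        · have hsk : s k = 1 := by simp [hs, hki, hkj]
          simp_rw [hwi]
          rw [hsk, one_mul]
          gcongr with l _
          rw [one_mul]
          exact mul_le_of_le_one_left (sq_nonneg _) (hs1 l)
    have hle : F v ≤ F w := by
      rw [hF, hF]
      refine ciInf_mono (Set.finite_range _).bddBelow fun k => ?_
      have hp : 0 < σ ^ 2 + ∑ l ∈ Finset.univ.erase k, ⟪v k, v l⟫_ℝ ^ 2 :=
        add_pos_of_pos_of_nonneg hσ' (Finset.sum_nonneg fun l _ => sq_nonneg _)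
      have hp' : 0 < σ ^ 2 + ∑ l ∈ Finset.univ.erase k, ⟪w k, w l⟫_ℝ ^ 2 :=
        add_pos_of_pos_of_nonneg hσ' (Finset.sum_nonneg fun l _ => sq_nonneg _)
      rw [div_le_div_iff₀ hp hp', hwn]
      have := mul_le_mul_of_nonneg_left (hden k) (sq_nonneg ‖v k‖)
      linarith
    have hsum := hmin w hwS (le_antisymm (hmax w hwS) hle)
    have : ∑ k, ‖w k‖ ^ 2 < ∑ k, ‖v k‖ ^ 2 := by
      refine Finset.sum_lt_sum (fun k _ => ?_) ⟨i, Finset.mem_univ _, ?_⟩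
      · rw [hwn]
        exact mul_le_of_le_one_left (sq_nonneg _) (hs1 k)
      · rw [hwn]
        have hsi : s i = x := by simp [hs]
        rw [hsi]
        exact mul_lt_of_lt_one_left (by linarith) hx1
    linarith
  have hd' : (2:ℝ) ≤ d := by exact_mod_cast hd
  rw [le_div_iff₀ (by linarith)]
  rcases Nat.eq_zero_or_pos (Finset.univ.filter fun i => c1 < ‖v i‖ ^ 2).card with h0 | h0
  · rw [h0, Nat.cast_zero, zero_mul]
    have : 0 ≤ c1 ^ 2 - σ ^ 2 := by nlinarith [sq_nonneg σ]
    positivity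
  · have := card_bound _ v c1 (σ ^ 2) hc1 (fun i _ => (hv i).1) hpair h0
    linarith
end
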